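/- Assume α ≥ 3. Then for every n ≥ 1 and every m ∈ ℕ, the real sequence k ↦ s_{k,m}(n)/s_k(n) satisfies 1 + 2m/α ≤ liminf_{k→∞} s_{k,m}(n)/s_k(n) ≤ limsup_{k→∞} s_{k,m}(n)/s_k(n) ≤ 1 + 2αm. -/

import Mathlib

/-- The multiplicative weight `α ^ o`, where `o` is the number of odd terms among the first `k`
terms of the `C`-orbit of `n`. -/
def oddWeight (α : ℕ) (C : ℕ → ℕ) (k n : ℕ) : ℕ :=
  ∏ i ∈ Finset.range k, if C^[i] n % 2 = 0 then 1 else α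

section Collatz

variable {α β : ℕ} {C : ℕ → ℕ}

theorem oddWeight_succ (k n : ℕ) :
    oddWeight α C (k + 1) n = oddWeight α C k n * if C^[k] n % 2 = 0 then 1 else α :=
  Finset.prod_range_succ _ _

theorem odd_oddWeight (hα : Odd α) (k n : ℕ) : Odd (oddWeight α C k n) := by
  induction k with
  | zero => simp [oddWeight]
  | succ k ih =>
    rw [oddWeight_succ]
    refine ih.mul ?_
    split_ifs
    exacts [odd_one, hα]

theorem collatz_add_two_mul
    (hC : ∀ n : ℕ, C n = if n % 2 = 0 then n / 2 else (α * n + β) / 2) (a t : ℕ) :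
    C (a + 2 * t) = C a + t * if a % 2 = 0 then 1 else α := by
  rw [hC, hC, Nat.add_mul_mod_self_left]
  split_ifs
  · omega
  · rw [show α * (a + 2 * t) + β = α * a + β + 2 * (t * α) by ring]
    omega

theorem iterate_collatz_add_mul_two_pow
    (hC : ∀ n : ℕ, C n = if n % 2 = 0 then n / 2 else (α * n + β) / 2) (k n t : ℕ) :
    C^[k] (n + t * 2 ^ k) = C^[k] n + t * oddWeight α C k n ∧
      oddWeight α C k (n + t * 2 ^ k) = oddWeight α C k n := by
  induction k generalizing t with
  | zero => simp [oddWeight]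
  | succ k ih =>
    obtain ⟨h₁, h₂⟩ := ih (2 * t)
    rw [show t * 2 ^ (k + 1) = 2 * t * 2 ^ k by ring, oddWeight_succ, oddWeight_succ,
      Function.iterate_succ_apply', Function.iterate_succ_apply', h₁, h₂, mul_assoc 2 t,
      collatz_add_two_mul hC, Nat.add_mul_mod_self_left]
    exact ⟨by ring, rfl⟩

theorem sum_range_two_pow_succ (f : ℕ → ℕ) (n k : ℕ) :
    ∑ j ∈ Finset.range (2 ^ (k + 1)), f (n + j) =
      ∑ j ∈ Finset.range (2 ^ k), (f (n + j) + f (n + j + 1 * 2 ^ k)) := by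
  rw [pow_succ, mul_two, Finset.sum_range_add, Finset.sum_add_distrib]
  congr 1
  refine Finset.sum_congr rfl fun j _ => ?_
  congr 1
  ring

theorem sum_oddWeight (hα : Odd α)
    (hC : ∀ n : ℕ, C n = if n % 2 = 0 then n / 2 else (α * n + β) / 2) (n k : ℕ) :
    ∑ j ∈ Finset.range (2 ^ k), oddWeight α C k (n + j) = (1 + α) ^ k := by
  induction k with
  | zero => simp [oddWeight]
  | succ k ih =>
    rw [sum_range_two_pow_succ, pow_succ, ← ih, Finset.sum_mul]
    refine Finset.sum_congr rfl fun j _ => ?_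
    obtain ⟨h₁, h₂⟩ := iterate_collatz_add_mul_two_pow hC k (n + j) 1
    have hodd := Nat.odd_iff.mp (odd_oddWeight (C := C) hα k (n + j))
    rw [oddWeight_succ, oddWeight_succ, h₁, h₂, ← mul_add]
    congr 1
    split_ifs <;> omega

theorem sum_iterate_collatz_shift (hα : Odd α)
    (hC : ∀ n : ℕ, C n = if n % 2 = 0 then n / 2 else (α * n + β) / 2) (n k m : ℕ) :
    ∑ j ∈ Finset.range (2 ^ k), C^[k] (n + j + m * 2 ^ k) =
      ∑ j ∈ Finset.range (2 ^ k), C^[k] (n + j) + m * (1 + α) ^ k := by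
  rw [← sum_oddWeight hα hC n k, Finset.mul_sum, ← Finset.sum_add_distrib]
  exact Finset.sum_congr rfl fun j _ =>
    (iterate_collatz_add_mul_two_pow hC k (n + j) m).1

theorem collatz_add_collatz_add_odd (hα : Odd α) (hβ : Odd β)
    (hC : ∀ n : ℕ, C n = if n % 2 = 0 then n / 2 else (α * n + β) / 2) (a : ℕ) {w : ℕ}
    (hw : Odd w) :
    (1 + α) * a + w ≤ 2 * (C a + C (a + w)) ∧
      2 * (C a + C (a + w)) ≤ (1 + α) * a + α * w + β := by
  have hle : w ≤ α * w := Nat.le_mul_of_pos_left w hα.pos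
  have hodd (x : ℕ) (hx : Odd x) : 2 * ((α * x + β) / 2) = α * x + β :=
    Nat.two_mul_div_two_of_even ((hα.mul hx).add_odd hβ)
  have hw' := Nat.odd_iff.mp hw
  rw [hC, hC]
  rcases Nat.even_or_odd a with ha | ha
  · have h := hodd _ (ha.add_odd hw)
    have ha' := Nat.even_iff.mp ha
    rw [if_pos ha', if_neg (by omega)]
    have : (1 + α) * a = a + α * a := by ring
    rw [mul_add α] at h ⊢
    omega
  · have h := hodd _ ha
    have ha' := Nat.odd_iff.mp ha
    rw [if_neg (by omega), if_pos (by omega)]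
    have : (1 + α) * a = a + α * a := by ring
    omega

theorem sum_iterate_collatz_succ_bounds (hα : Odd α) (hβ : Odd β)
    (hC : ∀ n : ℕ, C n = if n % 2 = 0 then n / 2 else (α * n + β) / 2) (n k : ℕ) :
    (1 + α) * ∑ j ∈ Finset.range (2 ^ k), C^[k] (n + j) + (1 + α) ^ k ≤
        2 * ∑ j ∈ Finset.range (2 ^ (k + 1)), C^[k + 1] (n + j) ∧
      2 * ∑ j ∈ Finset.range (2 ^ (k + 1)), C^[k + 1] (n + j) ≤
        (1 + α) * ∑ j ∈ Finset.range (2 ^ k), C^[k] (n + j) + α * (1 + α) ^ k + 2 ^ k * β := by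
  have key (j : ℕ) := collatz_add_collatz_add_odd hα hβ hC (C^[k] (n + j))
    (odd_oddWeight (C := C) hα k (n + j))
  have hsum : 2 * ∑ j ∈ Finset.range (2 ^ (k + 1)), C^[k + 1] (n + j) =
      ∑ j ∈ Finset.range (2 ^ k),
        2 * (C (C^[k] (n + j)) + C (C^[k] (n + j) + oddWeight α C k (n + j))) := by
    rw [sum_range_two_pow_succ, Finset.mul_sum]
    refine Finset.sum_congr rfl fun j _ => ?_
    rw [Function.iterate_succ_apply', Function.iterate_succ_apply',
      (iterate_collatz_add_mul_two_pow hC k (n + j) 1).1, one_mul]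
  have hconst : 2 ^ k * β = ∑ _j ∈ Finset.range (2 ^ k), β := by simp
  rw [hsum, ← sum_oddWeight hα hC n k, hconst, Finset.mul_sum, Finset.mul_sum,
    ← Finset.sum_add_distrib, ← Finset.sum_add_distrib, ← Finset.sum_add_distrib]
  exact ⟨Finset.sum_le_sum fun j _ => (key j).1, Finset.sum_le_sum fun j _ => (key j).2⟩

theorem pow_le_mul_sum_iterate_collatz (hα : Odd α) (hβ : Odd β)
    (hC : ∀ n : ℕ, C n = if n % 2 = 0 then n / 2 else (α * n + β) / 2) {n : ℕ} (hn : 1 ≤ n)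
    (k : ℕ) :
    (1 + α) ^ k ≤ (1 + α) * ∑ j ∈ Finset.range (2 ^ k), C^[k] (n + j) := by
  induction k with
  | zero =>
    simp only [pow_zero, Finset.range_one, Finset.sum_singleton, Function.iterate_zero, id,
      add_zero]
    nlinarith
  | succ k ih =>
    have h := (sum_iterate_collatz_succ_bounds hα hβ hC n k).1
    rw [pow_succ]
    nlinarith

theorem mul_sum_iterate_collatz_le (hα : Odd α) (hβ : Odd β)
    (hC : ∀ n : ℕ, C n = if n % 2 = 0 then n / 2 else (α * n + β) / 2) (hα3 : 3 ≤ α)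
    (n k : ℕ) :
    2 ^ k * (1 + α) * ∑ j ∈ Finset.range (2 ^ k), C^[k] (n + j) ≤
      (1 + α) ^ k * (α * 2 ^ k + (n + β * k) * (1 + α)) := by
  induction k with
  | zero => simp; nlinarith
  | succ k ih =>
    have h := (sum_iterate_collatz_succ_bounds hα hβ hC n k).2
    have hpow : 2 ^ k * 2 ^ k ≤ (1 + α) ^ k := by
      rw [← mul_pow]
      exact Nat.pow_le_pow_left (by omega) k
    calc 2 ^ (k + 1) * (1 + α) * ∑ j ∈ Finset.range (2 ^ (k + 1)), C^[k + 1] (n + j)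
        = 2 ^ k * (1 + α) * (2 * ∑ j ∈ Finset.range (2 ^ (k + 1)), C^[k + 1] (n + j)) := by ring
      _ ≤ 2 ^ k * (1 + α) * ((1 + α) * ∑ j ∈ Finset.range (2 ^ k), C^[k] (n + j) +
            α * (1 + α) ^ k + 2 ^ k * β) := Nat.mul_le_mul_left _ h
      _ = (1 + α) * (2 ^ k * (1 + α) * ∑ j ∈ Finset.range (2 ^ k), C^[k] (n + j)) +
            2 ^ k * α * (1 + α) ^ (k + 1) + (1 + α) * β * (2 ^ k * 2 ^ k) := by ring
      _ ≤ (1 + α) * ((1 + α) ^ k * (α * 2 ^ k + (n + β * k) * (1 + α))) +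
            2 ^ k * α * (1 + α) ^ (k + 1) + (1 + α) * β * ((1 + α) * (1 + α) ^ k) := by
          exact add_le_add (by gcongr)
            (Nat.mul_le_mul_left _ (hpow.trans (Nat.le_mul_of_pos_left _ (by positivity))))
      _ = (1 + α) ^ (k + 1) * (α * 2 ^ (k + 1) + (n + β * (k + 1 : ℕ)) * (1 + α)) := by
          ring

theorem eventually_linear_mul_le_two_pow (a b c : ℕ) :
    ∀ᶠ k : ℕ in Filter.atTop, (a + b * k) * c ≤ 2 ^ k := by
  have h₀ := tendsto_pow_const_div_const_pow_of_one_lt 0 (one_lt_two (α := ℝ))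
  have h₁ := tendsto_pow_const_div_const_pow_of_one_lt 1 (one_lt_two (α := ℝ))
  have h := (h₀.const_mul ((a : ℝ) * c)).add (h₁.const_mul ((b : ℝ) * c))
  simp only [mul_zero, add_zero] at h
  filter_upwards [h.eventually_le_const one_pos] with k hk
  have hpos : (0 : ℝ) < 2 ^ k := by positivity
  have hk' : ((a : ℝ) + b * k) * c / 2 ^ k ≤ 1 := by
    refine le_of_eq_of_le ?_ hk
    ring
  rw [div_le_one hpos] at hk'
  exact_mod_cast hk'

theorem eventually_two_mul_sum_iterate_collatz_le (hα : Odd α) (hβ : Odd β)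
    (hC : ∀ n : ℕ, C n = if n % 2 = 0 then n / 2 else (α * n + β) / 2) (hα3 : 3 ≤ α) (n : ℕ) :
    ∀ᶠ k : ℕ in Filter.atTop,
      2 * ∑ j ∈ Finset.range (2 ^ k), C^[k] (n + j) ≤ α * (1 + α) ^ k := by
  filter_upwards [eventually_linear_mul_le_two_pow n β (1 + α)] with k hk
  have h := mul_sum_iterate_collatz_le hα hβ hC hα3 n k
  refine le_of_mul_le_mul_left ?_ (by positivity : 0 < 2 ^ k * (1 + α))
  calc 2 ^ k * (1 + α) * (2 * ∑ j ∈ Finset.range (2 ^ k), C^[k] (n + j))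
      = 2 * (2 ^ k * (1 + α) * ∑ j ∈ Finset.range (2 ^ k), C^[k] (n + j)) := by ring
    _ ≤ 2 * ((1 + α) ^ k * (α * 2 ^ k + 2 ^ k)) := by
        exact Nat.mul_le_mul_left _ (h.trans (by gcongr))
    _ = 2 ^ k * (1 + α) * (2 * (1 + α) ^ k) := by ring
    _ ≤ 2 ^ k * (1 + α) * (α * (1 + α) ^ k) := by
        gcongr
        omega

end Collatz

/-- for α ≥ 3, bounds on liminf/limsup of s_{k,m}(n)/s_k(n) as k → ∞. -/
theorem collatz_ratio_liminf_limsup_ge_three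
    (α β : ℕ) (hα : Odd α) (hα0 : 0 < α) (hβ : Odd β) (hβ0 : 0 < β)
    (hgcd : Nat.gcd α β = 1) (C : ℕ → ℕ)
    (hC : ∀ n : ℕ, C n = if n % 2 = 0 then n / 2 else (α * n + β) / 2)
    (hα3 : 3 ≤ α) (n : ℕ) (hn : 1 ≤ n) (m : ℕ) :
    1 + 2 * (m : ℝ) / (α : ℝ) ≤
      Filter.liminf (fun k : ℕ =>
        ((∑ j ∈ Finset.range (2 ^ k), C^[k] (n + j + m * 2 ^ k) : ℕ) : ℝ)
          / ((∑ j ∈ Finset.range (2 ^ k), C^[k] (n + j) : ℕ) : ℝ)) Filter.atTop ∧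
    Filter.liminf (fun k : ℕ =>
        ((∑ j ∈ Finset.range (2 ^ k), C^[k] (n + j + m * 2 ^ k) : ℕ) : ℝ)
          / ((∑ j ∈ Finset.range (2 ^ k), C^[k] (n + j) : ℕ) : ℝ)) Filter.atTop ≤
      Filter.limsup (fun k : ℕ =>
        ((∑ j ∈ Finset.range (2 ^ k), C^[k] (n + j + m * 2 ^ k) : ℕ) : ℝ)
          / ((∑ j ∈ Finset.range (2 ^ k), C^[k] (n + j) : ℕ) : ℝ)) Filter.atTop ∧
    Filter.limsup (fun k : ℕ =>
        ((∑ j ∈ Finset.range (2 ^ k), C^[k] (n + j + m * 2 ^ k) : ℕ) : ℝ)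
          / ((∑ j ∈ Finset.range (2 ^ k), C^[k] (n + j) : ℕ) : ℝ)) Filter.atTop ≤
      1 + 2 * (α : ℝ) * (m : ℝ) := by
  set f : ℕ → ℝ := fun k =>
    ((∑ j ∈ Finset.range (2 ^ k), C^[k] (n + j + m * 2 ^ k) : ℕ) : ℝ)
      / ((∑ j ∈ Finset.range (2 ^ k), C^[k] (n + j) : ℕ) : ℝ) with hf
  have hpos (k : ℕ) : 0 < ∑ j ∈ Finset.range (2 ^ k), C^[k] (n + j) :=
    Nat.pos_of_mul_pos_left
      ((by positivity : 0 < (1 + α) ^ k).trans_le (pow_le_mul_sum_iterate_collatz hα hβ hC hn k))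
  have hf_eq (k : ℕ) : f k = 1 + m * ((1 + α) ^ k /
      ((∑ j ∈ Finset.range (2 ^ k), C^[k] (n + j) : ℕ) : ℝ)) := by
    have h : ((∑ j ∈ Finset.range (2 ^ k), C^[k] (n + j) : ℕ) : ℝ) ≠ 0 :=
      Nat.cast_ne_zero.mpr (hpos k).ne'
    simp only [hf]
    rw [sum_iterate_collatz_shift hα hC, Nat.cast_add, add_div, div_self h]
    push_cast
    ring
  have hα3' : (3 : ℝ) ≤ α := by exact_mod_cast hα3
  have upper : ∀ᶠ k in Filter.atTop, f k ≤ 1 + 2 * (α : ℝ) * m := by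
    refine Filter.Eventually.of_forall fun k => ?_
    have h : (1 + (α : ℝ)) ^ k ≤
        (1 + α) * ((∑ j ∈ Finset.range (2 ^ k), C^[k] (n + j) : ℕ) : ℝ) := by
      exact_mod_cast pow_le_mul_sum_iterate_collatz hα hβ hC hn k
    rw [hf_eq, mul_comm (2 * (α : ℝ))]
    gcongr
    exact ((div_le_iff₀ (Nat.cast_pos.mpr (hpos k))).mpr h).trans (by linarith)
  have lower : ∀ᶠ k in Filter.atTop, 1 + 2 * (m : ℝ) / α ≤ f k := by
    filter_upwards [eventually_two_mul_sum_iterate_collatz_le hα hβ hC hα3 n] with k hk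
    have h : 2 * ((∑ j ∈ Finset.range (2 ^ k), C^[k] (n + j) : ℕ) : ℝ) ≤
        α * (1 + (α : ℝ)) ^ k := by
      exact_mod_cast hk
    rw [hf_eq, mul_comm 2 (m : ℝ), mul_div_assoc]
    have hpos' : (0 : ℝ) < (∑ j ∈ Finset.range (2 ^ k), C^[k] (n + j) : ℕ) :=
      Nat.cast_pos.mpr (hpos k)
    gcongr 1 + m * ?_
    rw [div_le_div_iff₀ (by positivity) hpos']
    linarith
  have hle : Filter.IsBoundedUnder (· ≤ ·) Filter.atTop f := ⟨_, upper⟩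
  have hge : Filter.IsBoundedUnder (· ≥ ·) Filter.atTop f := ⟨_, lower⟩
  exact ⟨Filter.le_liminf_of_le hle.isCoboundedUnder_ge lower, Filter.liminf_le_limsup hle hge,
    Filter.limsup_le_of_le hge.isCoboundedUnder_le upper⟩
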